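/- There exists no finite matchstick graph in which every vertex has degree at least 6. In particular, for every r ≥ 6 there is no finite r-regular matchstick graph. -/

import Mathlib

/-- A matchstick embedding of a simple graph `G` in the plane: an injective map
`g` of the vertices into `ℝ²` such that every edge joins points at Euclidean
distance `1`, and the closed segments of any two vertex-disjoint edges are
disjoint. -/
def IsMatchstickEmbedding {V : Type*} (G : SimpleGraph V)
    (g : V → EuclideanSpace ℝ (Fin 2)) : Prop :=
  Function.Injective g ∧
  (∀ i j : V, G.Adj i j → dist (g i) (g j) = 1) ∧
  (∀ i₁ j₁ i₂ j₂ : V, G.Adj i₁ j₁ → G.Adj i₂ j₂ →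
    ({i₁, j₁} : Set V) ∩ ({i₂, j₂} : Set V) = ∅ →
    segment ℝ (g i₁) (g j₁) ∩ segment ℝ (g i₂) (g j₂) = ∅)

/-- Slope of the line through the (sheared) images of two vertices. -/
noncomputable def mslope {V : Type} (X Y : V → ℝ) (v u : V) : ℝ := (Y u - Y v) / (X u - X v)

/-- Height at abscissa `x` of the line through the (sheared) images of two vertices. -/
noncomputable def mline {V : Type} (X Y : V → ℝ) (v u : V) (x : ℝ) : ℝ :=
  Y v + mslope X Y v u * (x - X v)

/-- The combinatorial form of non-crossing used below. -/
def NoCross {V : Type} (G : SimpleGraph V) (X Y : V → ℝ) : Prop :=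
  ∀ v u v' z : V, G.Adj v u → G.Adj v' z → v ≠ v' → v ≠ z → u ≠ v' → u ≠ z →
    ∀ x : ℝ, X v ≤ x → x ≤ X u → X v' ≤ x → x ≤ X z → X v < X u → X v' < X z →
      mline X Y v u x = mline X Y v' z x → False

lemma mline_right {V : Type} (X Y : V → ℝ) (v u : V) (h : X v < X u) :
    mline X Y v u (X u) = Y u := by
  unfold mline mslope
  have : X u - X v ≠ 0 := by linarith
  field_simp
  ring

lemma mline_left {V : Type} (X Y : V → ℝ) (v u : V) : mline X Y v u (X v) = Y v := by
  unfold mline; ring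

lemma cross_false {V : Type} {G : SimpleGraph V} {X Y : V → ℝ} (hX : Function.Injective X)
    (hc : NoCross G X Y) {v u v' z : V} (h1 : G.Adj v u) (h2 : G.Adj v' z) {t : ℝ}
    (a1 : X v < X v') (a2 : X v' < t) (a3 : t ≤ X u) (a4 : t ≤ X z)
    (hs : (mline X Y v u (X v') - Y v') * (mline X Y v u t - mline X Y v' z t) < 0) : False := by
  have hvu : X v < X u := by linarith
  have hvz : X v' < X z := by linarith
  have e1 := mline_left X Y v' z
  rw [← e1] at hs
  set A := mline X Y v u (X v') - mline X Y v' z (X v') with hA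
  set B := mline X Y v u t - mline X Y v' z t with hB
  have hD : ∀ x, (mline X Y v u x - mline X Y v' z x) * (t - X v')
      = A * (t - x) + B * (x - X v') := by
    intro x; rw [hA, hB]; unfold mline; ring
  have hAB : A - B ≠ 0 := by
    intro h
    have : A = B := by linarith
    rw [this] at hs; nlinarith [sq_nonneg B]
  have hpos : t - X v' ≠ 0 := by linarith
  by_cases huz : u = z
  · subst huz
    have h := hD (X u)
    rw [mline_right X Y v u hvu, mline_right X Y v' u hvz, sub_self, zero_mul] at h
    have h' : A * A * (X u - t) = A * B * (X u - X v') := by linear_combination A * h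
    nlinarith [mul_self_nonneg A, mul_nonneg (mul_self_nonneg A) (sub_nonneg.2 a3),
      mul_pos (neg_pos.2 hs) (show (0:ℝ) < X u - X v' by linarith)]
  · -- crossing abscissa
    have key : ∃ c : ℝ, 0 ≤ c ∧ c ≤ 1 ∧ A * (1 - c) + B * c = 0 := by
      refine ⟨A / (A - B), ?_, ?_, ?_⟩
      · rcases lt_or_gt_of_ne hAB with h | h
        · apply div_nonneg_of_nonpos _ h.le
          by_contra hh; push Not at hh; nlinarith
        · apply div_nonneg _ h.le
          by_contra hh; push Not at hh; nlinarith
      · rcases lt_or_gt_of_ne hAB with h | h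
        · rw [div_le_one_of_neg h]
          by_contra hh; push Not at hh; nlinarith
        · rw [div_le_one h]
          by_contra hh; push Not at hh; nlinarith
      · field_simp; ring
    obtain ⟨c, c0, c1, hcc⟩ := key
    have b1 : X v' ≤ X v' + c * (t - X v') := by nlinarith
    have b2 : X v' + c * (t - X v') ≤ t := by nlinarith
    refine hc v u v' z h1 h2 ?_ ?_ ?_ huz (X v' + c * (t - X v')) (by linarith) (by linarith)
      (by linarith) (by linarith) hvu hvz ?_
    · rintro rfl; exact lt_irrefl _ a1
    · rintro rfl; linarith
    · rintro rfl; linarith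
    · have h := hD (X v' + c * (t - X v'))
      have : (mline X Y v u (X v' + c * (t - X v')) - mline X Y v' z (X v' + c * (t - X v')))
          * (t - X v') = 0 := by
        rw [h]; linear_combination (t - X v') * hcc
      rcases mul_eq_zero.1 this with h | h
      · linarith
      · exact absurd h hpos

/-- `p` is the first vertex seen from the wedge at `v` between `u` (top) and `w` (bottom). -/
def Sees {V : Type} (G : SimpleGraph V) (X Y : V → ℝ) (v u w p : V) : Prop :=
  (G.Adj v u ∧ X v < X u) ∧ (G.Adj v w ∧ X v < X w) ∧
  mslope X Y v w < mslope X Y v u ∧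
  (∀ z, G.Adj v z → X v < X z → mslope X Y v z < mslope X Y v u →
    mslope X Y v z ≤ mslope X Y v w) ∧
  (X v < X p ∧ X p ≤ X u ∧ X p ≤ X w ∧ Y p ≤ mline X Y v u (X p) ∧ mline X Y v w (X p) ≤ Y p) ∧
  (∀ q, X v < X q → X q < X p → Y q ≤ mline X Y v u (X q) → mline X Y v w (X q) ≤ Y q → False)

lemma exists_sees {V : Type} [Finite V] {G : SimpleGraph V} {X Y : V → ℝ} {v u w : V}
    (hu : G.Adj v u ∧ X v < X u) (hw : G.Adj v w ∧ X v < X w)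
    (hs : mslope X Y v w < mslope X Y v u) : ∃ w' p, Sees G X Y v u w' p := by
  obtain ⟨w', ⟨hw', hs'⟩, hmax⟩ := Set.exists_max_image
    {z | (G.Adj v z ∧ X v < X z) ∧ mslope X Y v z < mslope X Y v u} (mslope X Y v)
    (Set.toFinite _) ⟨w, hw, hs⟩
  have hne : {q | X v < X q ∧ X q ≤ X u ∧ X q ≤ X w' ∧ Y q ≤ mline X Y v u (X q) ∧
      mline X Y v w' (X q) ≤ Y q}.Nonempty := by
    rcases le_total (X u) (X w') with h | h
    · refine ⟨u, hu.2, le_rfl, h, (mline_right X Y v u hu.2).ge, ?_⟩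
      rw [← mline_right X Y v u hu.2]
      unfold mline
      nlinarith [hu.2]
    · refine ⟨w', hw'.2, h, le_rfl, ?_, (mline_right X Y v w' hw'.2).le⟩
      rw [← mline_right X Y v w' hw'.2]
      unfold mline
      nlinarith [hw'.2]
  obtain ⟨p, hp, hmin⟩ := Set.exists_min_image _ X (Set.toFinite _) hne
  refine ⟨w', p, hu, hw', hs', fun z a b c => hmax z ⟨⟨a, b⟩, c⟩, hp, ?_⟩
  intro q h1 h2 h3 h4
  have := hmin q ⟨h1, h2.le.trans hp.2.1, h2.le.trans hp.2.2.1, h3, h4⟩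
  linarith

lemma sees_no_lt {V : Type} {G : SimpleGraph V} {X Y : V → ℝ} (hX : Function.Injective X)
    (hc : NoCross G X Y) {v u w v' u' w' p : V} (h : Sees G X Y v u w p)
    (h' : Sees G X Y v' u' w' p)
    (ht : (Y p < mline X Y v u (X p) ∧ Y p < mline X Y v' u' (X p)) ∨
      (mline X Y v w (X p) < Y p ∧ mline X Y v' w' (X p) < Y p)) (hlt : X v < X v') : False := by
  obtain ⟨hu, hw, hs, hm, ⟨p1, p2, p3, p4, p5⟩, hf⟩ := h
  obtain ⟨hu', hw', hs', hm', ⟨q1, q2, q3, q4, q5⟩, hf'⟩ := h'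
  by_cases ha : Y v' ≤ mline X Y v u (X v')
  · by_cases hb : mline X Y v w (X v') ≤ Y v'
    · exact hf v' hlt q1 ha hb
    · push Not at hb
      refine cross_false hX hc hw.1 hu'.1 hlt q1 p3 q2 ?_
      apply mul_neg_of_pos_of_neg
      · linarith
      · rcases ht with ht | ht <;> linarith
  · push Not at ha
    refine cross_false hX hc hu.1 hw'.1 hlt q1 p2 q3 ?_
    apply mul_neg_of_neg_of_pos
    · linarith
    · rcases ht with ht | ht <;> linarith

lemma sees_slope {V : Type} {G : SimpleGraph V} {X Y : V → ℝ}
    {v u w u' w' p : V} (h : Sees G X Y v u w p) (h' : Sees G X Y v u' w' p)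
    (ht : (Y p < mline X Y v u (X p) ∧ Y p < mline X Y v u' (X p)) ∨
      (mline X Y v w (X p) < Y p ∧ mline X Y v w' (X p) < Y p)) :
    mslope X Y v u ≤ mslope X Y v u' := by
  obtain ⟨hu, hw, hs, hm, ⟨p1, p2, p3, p4, p5⟩, hf⟩ := h
  obtain ⟨hu', hw', hs', hm', ⟨q1, q2, q3, q4, q5⟩, hf'⟩ := h'
  by_contra hlt
  push Not at hlt
  have h1 := hm u' hu'.1 hu'.2 hlt
  have h2 : mline X Y v u' (X p) ≤ mline X Y v w (X p) := by
    unfold mline; nlinarith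
  rcases ht with ht | ht <;> linarith

lemma sees_unique {V : Type} {G : SimpleGraph V} {X Y : V → ℝ} (hX : Function.Injective X)
    (hc : NoCross G X Y)
    (hsl : ∀ v u u', G.Adj v u → G.Adj v u' → X v < X u → X v < X u' →
      mslope X Y v u = mslope X Y v u' → u = u')
    {v u w v' u' w' p : V} (h : Sees G X Y v u w p) (h' : Sees G X Y v' u' w' p)
    (ht : (Y p < mline X Y v u (X p) ∧ Y p < mline X Y v' u' (X p)) ∨
      (mline X Y v w (X p) < Y p ∧ mline X Y v' w' (X p) < Y p)) : v = v' ∧ u = u' := by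
  have ht' : (Y p < mline X Y v' u' (X p) ∧ Y p < mline X Y v u (X p)) ∨
      (mline X Y v' w' (X p) < Y p ∧ mline X Y v w (X p) < Y p) := by
    rcases ht with ht | ht
    · exact Or.inl ht.symm
    · exact Or.inr ht.symm
  have hv : v = v' := by
    rcases lt_trichotomy (X v) (X v') with hl | hl | hl
    · exact (sees_no_lt hX hc h h' ht hl).elim
    · exact hX hl
    · exact (sees_no_lt hX hc h' h ht' hl).elim
  subst hv
  exact ⟨rfl, hsl v u u' h.1.1 h'.1.1 h.1.2 h'.1.2
    (le_antisymm (sees_slope h h' ht) (sees_slope h' h ht'))⟩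

open Classical in
lemma count_false {V : Type} [Fintype V] [Nonempty V] {G : SimpleGraph V} {X Y : V → ℝ}
    (hX : Function.Injective X) (hc : NoCross G X Y)
    (hsl : ∀ v u u', G.Adj v u → G.Adj v u' → X v < X u → X v < X u' →
      mslope X Y v u = mslope X Y v u' → u = u')
    (hdeg : ∀ v : V, 6 ≤ (G.neighborSet v).ncard) : False := by
  let D : Finset (V × V) := Finset.univ.filter fun e => G.Adj e.1 e.2
  let P : Finset (V × V) := Finset.univ.filter fun e => G.Adj e.1 e.2 ∧ X e.1 < X e.2
  let W : Finset (V × V) := P.filter fun e => ∃ w, (G.Adj e.1 w ∧ X e.1 < X w) ∧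
    mslope X Y e.1 w < mslope X Y e.1 e.2
  have hD : 6 * Fintype.card V ≤ D.card := by
    have : D.card = ∑ v : V, (G.neighborSet v).ncard := by
      rw [Finset.card_eq_sum_card_fiberwise (f := Prod.fst) (t := Finset.univ) (by simp)]
      refine Finset.sum_congr rfl fun v _ => ?_
      rw [Set.ncard_eq_toFinset_card']
      refine Finset.card_bij' (fun e _ => e.2) (fun u _ => (v, u)) ?_ ?_ ?_ ?_
      · rintro ⟨a, b⟩ h; simp [D] at h ⊢; rw [← h.2]; exact h.1
      · intro b h; simpa [D] using h
      · rintro ⟨a, b⟩ h; simp [D] at h ⊢; exact h.2.symm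
      · intro b h; rfl
    rw [this]
    calc 6 * Fintype.card V = ∑ v : V, 6 := by simp [mul_comm]
      _ ≤ _ := Finset.sum_le_sum fun v _ => hdeg v
  have hDP : D.card ≤ 2 * P.card := by
    have hsub : D ⊆ P ∪ P.image Prod.swap := by
      rintro ⟨a, b⟩ h
      simp only [D, Finset.mem_filter, Finset.mem_univ, true_and] at h
      rcases lt_trichotomy (X a) (X b) with hl | hl | hl
      · simp [P, h, hl]
      · exact absurd (hX hl) h.ne
      · simp [P, h.symm, hl]
    have h1 := Finset.card_le_card hsub
    have h2 := Finset.card_union_le P (P.image Prod.swap)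
    have h3 : (P.image Prod.swap).card ≤ P.card := Finset.card_image_le
    omega
  have hPW : (P \ W).card ≤ Fintype.card V - 1 := by
    obtain ⟨m, -, hm⟩ := Finset.exists_max_image (Finset.univ : Finset V) X Finset.univ_nonempty
    have : (P \ W).card ≤ (Finset.univ.erase m).card := by
      refine Finset.card_le_card_of_injOn Prod.fst ?_ ?_
      · rintro ⟨a, b⟩ h
        simp only [P, W, Finset.coe_sdiff, Set.mem_sdiff, Finset.mem_coe, Finset.mem_filter,
          Finset.mem_univ, true_and] at h
        simp only [Finset.mem_coe, Finset.mem_erase, Finset.mem_univ, and_true]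
        rintro rfl
        have := hm b (Finset.mem_univ _)
        linarith [h.1.2]
      · rintro ⟨a, b⟩ h ⟨a', b'⟩ h' hab
        simp only at hab
        subst hab
        simp only [P, W, Finset.coe_sdiff, Set.mem_sdiff, Finset.mem_coe, Finset.mem_filter,
          Finset.mem_univ, true_and, not_and, not_exists, not_lt] at h h'
        have e1 := h.2 h.1 b' h'.1
        have e2 := h'.2 h'.1 b h.1
        rw [hsl a b b' h.1.1 h'.1.1 h.1.2 h'.1.2 (le_antisymm e1 e2)]
    rwa [Finset.card_erase_of_mem (Finset.mem_univ _), Finset.card_univ] at this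
  have hW : W.card ≤ 2 * Fintype.card V := by
    have hex : ∀ e : V × V, ∃ q : V × V, e ∈ W → Sees G X Y e.1 e.2 q.1 q.2 := by
      intro e
      by_cases he : e ∈ W
      · have he' := he
        simp only [P, W, Finset.mem_filter, Finset.mem_univ, true_and] at he'
        obtain ⟨hu, w, hw, hs⟩ := he'
        obtain ⟨w', p, h⟩ := exists_sees hu hw hs
        exact ⟨(w', p), fun _ => h⟩
      · exact ⟨e, fun h => absurd h he⟩
    choose f hf using hex
    have : W.card ≤ (Finset.univ : Finset (V × Bool)).card := by
      refine Finset.card_le_card_of_injOn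
        (fun e => ((f e).2, decide (Y (f e).2 < mline X Y e.1 e.2 (X (f e).2)))) (by simp) ?_
      intro e he e' he' hee
      have h := hf e he
      have h' := hf e' he'
      simp only [Prod.mk.injEq, decide_eq_decide] at hee
      obtain ⟨h1, h2⟩ := hee
      rw [← h1] at h' h2
      have := sees_unique hX hc hsl h h' ?_
      · exact Prod.ext this.1 this.2
      by_cases hy : Y (f e).2 < mline X Y e.1 e.2 (X (f e).2)
      · exact Or.inl ⟨hy, h2.1 hy⟩
      · have hy' := fun hh => hy (h2.2 hh)
        right
        have aux : ∀ {v u w p : V}, Sees G X Y v u w p → ¬ Y p < mline X Y v u (X p) →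
            mline X Y v w (X p) < Y p := by
          intro v u w p hS hn
          obtain ⟨hu, hw, hs, hm, ⟨p1, p2, p3, p4, p5⟩, hf⟩ := hS
          push Not at hn
          refine lt_of_lt_of_le ?_ hn
          unfold mline; nlinarith
        exact ⟨aux h hy, aux h' hy'⟩
    simpa [mul_comm] using this
  have hPle : P.card ≤ (P \ W).card + W.card := by
    rw [Finset.card_sdiff_add_card_eq_card (Finset.filter_subset _ _)]
  have : 0 < Fintype.card V := Fintype.card_pos
  omega

lemma exists_shear {V : Type} [Finite V] (g : V → EuclideanSpace ℝ (Fin 2))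
    (hg : Function.Injective g) : ∃ t : ℝ, Function.Injective fun v => g v 0 + t * g v 1 := by
  have hfin : (Set.range fun e : V × V => -(g e.1 0 - g e.2 0) / (g e.1 1 - g e.2 1)).Finite :=
    Set.finite_range _
  obtain ⟨t, ht⟩ := hfin.exists_notMem
  refine ⟨t, fun a b hab => ?_⟩
  simp only at hab
  by_cases h1 : g a 1 = g b 1
  · apply hg
    ext i
    fin_cases i
    · simp only [h1] at hab; simpa using hab
    · simpa using h1
  · exfalso
    apply ht
    refine ⟨(a, b), ?_⟩
    have : g a 1 - g b 1 ≠ 0 := sub_ne_zero.2 h1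
    simp only
    field_simp
    linarith

lemma main_false {V : Type} [Fintype V] [Nonempty V] {G : SimpleGraph V}
    {g : V → EuclideanSpace ℝ (Fin 2)} (hdeg : ∀ v : V, 6 ≤ (G.neighborSet v).ncard)
    (hG : IsMatchstickEmbedding G g) : False := by
  obtain ⟨hinj, hdist, hdis⟩ := hG
  obtain ⟨t, ht⟩ := exists_shear g hinj
  refine count_false (X := fun v => g v 0 + t * g v 1) (Y := fun v => g v 1) ht ?_ ?_ hdeg
  · intro v u v' z h1 h2 n1 n2 n3 n4 x a1 a2 a3 a4 b1 b2 he
    have hd := hdis v u v' z h1 h2 (by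
      ext q
      simp only [Set.mem_inter_iff, Set.mem_insert_iff, Set.mem_singleton_iff,
        Set.mem_empty_iff_false, iff_false]
      rintro ⟨rfl | rfl, h | h⟩ <;> contradiction)
    have aux : ∀ a b : V, g a 0 + t * g a 1 ≤ x → x ≤ g b 0 + t * g b 1 →
        g a 0 + t * g a 1 < g b 0 + t * g b 1 →
        !₂[x - t * mline (fun v => g v 0 + t * g v 1) (fun v => g v 1) a b x,
          mline (fun v => g v 0 + t * g v 1) (fun v => g v 1) a b x] ∈
        segment ℝ (g a) (g b) := by
      intro a b c1 c2 c3
      have hne : (g b 0 + t * g b 1) - (g a 0 + t * g a 1) > 0 := by linarith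
      set d := (g b 0 + t * g b 1) - (g a 0 + t * g a 1) with hd
      rw [segment_eq_image']
      refine ⟨(x - (g a 0 + t * g a 1)) / d, ⟨div_nonneg (by linarith) hne.le,
        (div_le_one hne).2 (by linarith)⟩, ?_⟩
      have hx : x = (g a 0 + t * g a 1) + (x - (g a 0 + t * g a 1)) / d * d := by
        field_simp; ring
      have hm : mline (fun v => g v 0 + t * g v 1) (fun v => g v 1) a b x
          = g a 1 + (x - (g a 0 + t * g a 1)) / d * (g b 1 - g a 1) := by
        unfold mline mslope
        simp only [← hd]
        field_simp
      rw [hm]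
      generalize (x - (g a 0 + t * g a 1)) / d = c at *
      ext i
      fin_cases i
      · simp
        rw [hx, hd]; ring
      · simp
    have m1 := aux v u a1 a2 b1
    have m2 := aux v' z a3 a4 b2
    rw [← he] at m2
    have : _ ∈ (∅ : Set (EuclideanSpace ℝ (Fin 2))) := hd ▸ Set.mem_inter m1 m2
    exact this
  · intro v u u' h1 h2 b1 b2 hs
    have d1 := hdist v u h1
    have d2 := hdist v u' h2
    rw [EuclideanSpace.dist_eq, Real.sqrt_eq_one] at d1 d2
    simp only [Fin.sum_univ_two, Real.dist_eq, sq_abs] at d1 d2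
    simp only at b1 b2
    unfold mslope at hs
    simp only at hs
    rw [div_eq_div_iff (by linarith) (by linarith)] at hs
    apply ht
    simp only
    obtain ⟨a, ha⟩ : ∃ a, a = g u 0 - g v 0 := ⟨_, rfl⟩
    obtain ⟨b, hb⟩ : ∃ a, a = g u 1 - g v 1 := ⟨_, rfl⟩
    obtain ⟨a', ha'⟩ : ∃ a, a = g u' 0 - g v 0 := ⟨_, rfl⟩
    obtain ⟨b', hb'⟩ : ∃ a, a = g u' 1 - g v 1 := ⟨_, rfl⟩
    have e1 : a ^ 2 + b ^ 2 = 1 := by rw [ha, hb]; linarith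
    have e2 : a' ^ 2 + b' ^ 2 = 1 := by rw [ha', hb']; linarith
    have e3 : b * a' = b' * a := by rw [ha, hb, ha', hb']; linarith
    have p1 : 0 < a + t * b := by rw [ha, hb]; linarith
    have p2 : 0 < a' + t * b' := by rw [ha', hb']; linarith
    suffices hh : a + t * b = a' + t * b' by rw [ha, hb, ha', hb'] at hh; linarith
    have sq : (a + t * b) ^ 2 = (a' + t * b') ^ 2 := by
      have k1 : a * (a' + t * b') = a' * (a + t * b) := by linear_combination (-t) * e3
      have k2 : b * (a' + t * b') = b' * (a + t * b) := by linear_combination e3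
      have : (a ^ 2 + b ^ 2) * (a' + t * b') ^ 2 = (a' ^ 2 + b' ^ 2) * (a + t * b) ^ 2 := by
        linear_combination (a * (a' + t * b') + a' * (a + t * b)) * k1
          + (b * (a' + t * b') + b' * (a + t * b)) * k2
      rw [e1, e2] at this
      linarith
    nlinarith

/-- No finite matchstick graph with minimum degree at least `6` exists; in
particular, for every `r ≥ 6` there is no finite `r`-regular matchstick graph. -/
theorem no_finite_min_degree_six_matchstick_graph :
    (¬ ∃ (V : Type) (_ : Fintype V) (_ : Nonempty V) (G : SimpleGraph V)
        (g : V → EuclideanSpace ℝ (Fin 2)),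
      (∀ v : V, 6 ≤ (G.neighborSet v).ncard) ∧ IsMatchstickEmbedding G g) ∧
    (∀ r : ℕ, 6 ≤ r →
      ¬ ∃ (V : Type) (_ : Fintype V) (_ : Nonempty V) (G : SimpleGraph V)
          (g : V → EuclideanSpace ℝ (Fin 2)),
        (∀ v : V, (G.neighborSet v).ncard = r) ∧ IsMatchstickEmbedding G g) := by
  constructor
  · rintro ⟨V, i1, i2, G, g, hd, hG⟩
    exact main_false hd hG
  · rintro r hr ⟨V, i1, i2, G, g, hd, hG⟩
    exact main_false (fun v => hr.trans (hd v).ge) hG
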